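/- For every i with 1 ≤ i ≤ m+1, the matrix B_{m−i+2} is invertible and T_i = (B_{m−i+2})⁻¹ · B_B; equivalently, B_i⁻¹ · B_B = T_{m−i+2}. -/

import Mathlib

open Matrix

noncomputable section

/-- Lower triangular Toeplitz m×m matrix: entry (i,j) equals `a (i-j)` (0-based),
i.e. `a_{i-j+1}` in the 1-based notation of the paper, for j ≤ i, and 0 otherwise. -/
def lowT (m : ℕ) (a : Fin (m + 1) → ℝ) : Matrix (Fin m) (Fin m) ℝ :=
  fun i j =>
    if h : (j : ℕ) ≤ (i : ℕ) then a ⟨(i : ℕ) - (j : ℕ), by have := i.2; omega⟩ else 0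

/-- Upper triangular Toeplitz m×m matrix: entry (i,j) equals `a (m + i - j)` (0-based),
i.e. `a_{m+1+i-j}` in the 1-based notation of the paper, for i ≤ j, and 0 otherwise. -/
def upT (m : ℕ) (a : Fin (m + 1) → ℝ) : Matrix (Fin m) (Fin m) ℝ :=
  fun i j =>
    if h : (i : ℕ) ≤ (j : ℕ) then a ⟨m + (i : ℕ) - (j : ℕ), by have := j.2; omega⟩ else 0

/-- The 2m×2m Sylvester matrix S = [[D_L, N_L],[D_U, N_U]]. -/
def sylv (m : ℕ) (d n : Fin (m + 1) → ℝ) : Matrix (Fin (m + m)) (Fin (m + m)) ℝ :=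
  (fromBlocks (lowT m d) (lowT m n) (upT m d) (upT m n)).submatrix
    finSumFinEquiv.symm finSumFinEquiv.symm

/-- The 2m×2m lower triangular matrix D = [[D_L, 0],[D_U, D_L]]. -/
def dMat (m : ℕ) (d : Fin (m + 1) → ℝ) : Matrix (Fin (m + m)) (Fin (m + m)) ℝ :=
  (fromBlocks (lowT m d) (0 : Matrix (Fin m) (Fin m) ℝ) (upT m d) (lowT m d)).submatrix
    finSumFinEquiv.symm finSumFinEquiv.symm

/-- The m×2m matrix formed by the last m rows of a 2m×2m matrix. -/
def lastRows (m : ℕ) (M : Matrix (Fin (m + m)) (Fin (m + m)) ℝ) :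
    Matrix (Fin m) (Fin (m + m)) ℝ :=
  fun i j => M ⟨m + (i : ℕ), by have := i.2; omega⟩ j

/-- The m×m submatrix of an m×2m matrix consisting of the m consecutive columns
starting from column i (0-based; column i+1 in the 1-based notation of the paper). -/
def subCols (m : ℕ) (M : Matrix (Fin m) (Fin (m + m)) ℝ) (i : Fin (m + 1)) :
    Matrix (Fin m) (Fin m) ℝ :=
  fun r c => M r ⟨(i : ℕ) + (c : ℕ), by have := i.2; have := c.2; omega⟩

/-- The kernel T = ( -D_U·D_L⁻¹ | I_m | -D_L·D_U⁻¹ ), an m×3m matrix. -/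
def kerT (m : ℕ) (d : Fin (m + 1) → ℝ) : Matrix (Fin m) (Fin (m + m + m)) ℝ :=
  (fromCols
      (fromCols (-(upT m d * (lowT m d)⁻¹)) (1 : Matrix (Fin m) (Fin m) ℝ))
      (-(lowT m d * (upT m d)⁻¹))).submatrix id
    (((Equiv.sumCongr finSumFinEquiv (Equiv.refl (Fin m))).trans finSumFinEquiv).symm)

/-- T_i : the m×2m submatrix of T consisting of the 2m consecutive columns
starting from column i (0-based). -/
def tSub (m : ℕ) (d : Fin (m + 1) → ℝ) (i : Fin (m + 1)) :
    Matrix (Fin m) (Fin (m + m)) ℝ :=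
  fun r c => kerT m d r ⟨(i : ℕ) + (c : ℕ), by have := i.2; have := c.2; omega⟩

/-- T_{i,j} : the m×m submatrix of T_i consisting of the m consecutive columns
starting from column j (0-based). -/
def tSub2 (m : ℕ) (d : Fin (m + 1) → ℝ) (i j : Fin (m + 1)) :
    Matrix (Fin m) (Fin m) ℝ :=
  fun r c =>
    kerT m d r ⟨(i : ℕ) + (j : ℕ) + (c : ℕ), by have := i.2; have := j.2; have := c.2; omega⟩

/-- The 2m×m block column matrix [D_L; D_U]. -/
def dlMat (m : ℕ) (d : Fin (m + 1) → ℝ) : Matrix (Fin (m + m)) (Fin m) ℝ :=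
  (fromRows (lowT m d) (upT m d)).submatrix finSumFinEquiv.symm id

/-- The 2m×m block column matrix [0; D_L]. -/
def drMat (m : ℕ) (d : Fin (m + 1) → ℝ) : Matrix (Fin (m + m)) (Fin m) ℝ :=
  (fromRows (0 : Matrix (Fin m) (Fin m) ℝ) (lowT m d)).submatrix finSumFinEquiv.symm id

/-- The 2m×m block column matrix [N_L; N_U]. -/
def nMat (m : ℕ) (n : Fin (m + 1) → ℝ) : Matrix (Fin (m + m)) (Fin m) ℝ :=
  (fromRows (lowT m n) (upT m n)).submatrix finSumFinEquiv.symm id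

/-- The 3m×2m block matrix [[X_L, 0],[X_U, X_L],[0, X_U]] built from the
lower/upper triangular Toeplitz matrices of a. -/
def kMat (m : ℕ) (a : Fin (m + 1) → ℝ) : Matrix (Fin (m + m + m)) (Fin (m + m)) ℝ :=
  (fromRows
      (fromRows (fromCols (lowT m a) (0 : Matrix (Fin m) (Fin m) ℝ))
        (fromCols (upT m a) (lowT m a)))
      (fromCols (0 : Matrix (Fin m) (Fin m) ℝ) (upT m a))).submatrix
    (((Equiv.sumCongr finSumFinEquiv (Equiv.refl (Fin m))).trans finSumFinEquiv).symm)
    finSumFinEquiv.symm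

/-- Index reversal i ↦ m - i on 0-based indices, corresponding to the 1-based
index map i ↦ m - i + 2 of the paper. -/
def revIdx (m : ℕ) (i : Fin (m + 1)) : Fin (m + 1) := ⟨m - (i : ℕ), by omega⟩

/-- The entry in row `r` and column `c` of the infinite banded lower triangular Toeplitz
matrix with first column `a`. -/
def bandEntry (m : ℕ) (a : Fin (m + 1) → ℝ) (r c : ℕ) : ℝ :=
  if h : c ≤ r ∧ r ≤ c + m then a ⟨r - c, by omega⟩ else 0

theorem lowT_apply (m : ℕ) (a : Fin (m + 1) → ℝ) (i j : Fin m) :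
    lowT m a i j = bandEntry m a i j := by
  have := i.2
  have := j.2
  unfold lowT bandEntry
  split_ifs <;> first | rfl | omega

theorem upT_apply (m : ℕ) (a : Fin (m + 1) → ℝ) (i j : Fin m) :
    upT m a i j = bandEntry m a (m + i) j := by
  have := i.2
  have := j.2
  unfold upT bandEntry
  split_ifs <;> first | rfl | omega

theorem bandEntry_add_add (m : ℕ) (a : Fin (m + 1) → ℝ) (k r c : ℕ) :
    bandEntry m a (k + r) (k + c) = bandEntry m a r c := by
  unfold bandEntry
  split_ifs
  · congr 2; omega
  all_goals first | rfl | omega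

theorem bandEntry_of_lt (m : ℕ) (a : Fin (m + 1) → ℝ) {r c : ℕ} (h : r < c) :
    bandEntry m a r c = 0 :=
  dif_neg (by omega)

theorem bandEntry_of_add_lt (m : ℕ) (a : Fin (m + 1) → ℝ) {r c : ℕ} (h : c + m < r) :
    bandEntry m a r c = 0 :=
  dif_neg (by omega)

theorem dlMat_apply (m : ℕ) (a : Fin (m + 1) → ℝ) (r : Fin (m + m)) (c : Fin m) :
    dlMat m a r c = bandEntry m a r c := by
  refine Fin.addCases (fun i => ?_) (fun i => ?_) r
  · simp [dlMat, lowT_apply]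
  · simp [dlMat, upT_apply, -Fin.natAdd_eq_addNat]

theorem kMat_apply (m : ℕ) (a : Fin (m + 1) → ℝ) (r : Fin (m + m + m)) (c : Fin (m + m)) :
    kMat m a r c = bandEntry m a r c := by
  refine Fin.addCases (fun r => ?_) (fun i => ?_) r
  · refine Fin.addCases (fun i => ?_) (fun i => ?_) r <;>
    refine Fin.addCases (fun j => ?_) (fun j => ?_) c
    · simp [kMat, lowT_apply]
    · simp [kMat, bandEntry_of_lt m a (show (i : ℕ) < m + j by omega), -Fin.natAdd_eq_addNat]
    · simp [kMat, upT_apply, -Fin.natAdd_eq_addNat]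
    · simp [kMat, lowT_apply, bandEntry_add_add, -Fin.natAdd_eq_addNat]
  · refine Fin.addCases (fun j => ?_) (fun j => ?_) c
    · simp [kMat, bandEntry_of_add_lt m a (show (j : ℕ) + m < m + m + i by omega)]
    · simp [kMat, upT_apply, add_assoc, bandEntry_add_add, -Fin.natAdd_eq_addNat]

theorem isUnit_det_lowT (m : ℕ) (a : Fin (m + 1) → ℝ) (ha : ∀ k, a k ≠ 0) :
    IsUnit (lowT m a).det := by
  rw [isUnit_iff_ne_zero, det_of_isLowerTriangular]
  · exact Finset.prod_ne_zero_iff.2 fun i _ => by simp [lowT, ha]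
  · intro i j hij
    exact dif_neg (not_le.2 hij)

theorem isUnit_det_upT (m : ℕ) (a : Fin (m + 1) → ℝ) (ha : ∀ k, a k ≠ 0) :
    IsUnit (upT m a).det := by
  rw [isUnit_iff_ne_zero, det_of_isUpperTriangular]
  · exact Finset.prod_ne_zero_iff.2 fun i _ => by simp [upT, ha]
  · intro i j hij
    exact dif_neg (not_le.2 hij)

theorem kerT_mul_kMat (m : ℕ) (d : Fin (m + 1) → ℝ) (hd : ∀ k, d k ≠ 0) :
    kerT m d * kMat m d = 0 := by
  rw [kerT, kMat, submatrix_mul_equiv, fromCols_mul_fromRows, fromCols_mul_fromRows,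
    mul_fromCols, mul_fromCols, mul_fromCols, neg_mul, neg_mul, neg_mul, neg_mul,
    nonsing_inv_mul_cancel_right _ _ (isUnit_det_lowT m d hd),
    nonsing_inv_mul_cancel_right _ _ (isUnit_det_upT m d hd)]
  ext r c
  refine Fin.addCases (fun j => ?_) (fun j => ?_) c <;> simp [-Fin.natAdd_eq_addNat]

theorem tSub_mul_dlMat (m : ℕ) (d : Fin (m + 1) → ℝ) (hd : ∀ k, d k ≠ 0) (i : Fin (m + 1)) :
    tSub m d i * dlMat m d = 0 := by
  ext r j
  have hK := congrFun (congrFun (kerT_mul_kMat m d hd) r) ⟨i + j, by omega⟩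
  rw [mul_apply] at hK ⊢
  refine Eq.trans ?_ hK
  refine Fintype.sum_of_injective
    (fun c : Fin (m + m) => (⟨i + c, by omega⟩ : Fin (m + m + m))) ?_ _ _ ?_ ?_
  · intro x y hxy
    simpa [Fin.ext_iff] using hxy
  · intro x hx
    rw [kMat_apply]
    rcases lt_or_ge (x : ℕ) i with h | h
    · rw [bandEntry_of_lt _ _ (by simp only; omega), mul_zero]
    · rw [bandEntry_of_add_lt, mul_zero]
      by_contra hlt
      exact hx ⟨⟨x - i, by simp only at hlt; omega⟩, Fin.ext (by simp only; omega)⟩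
  · intro c
    rw [kMat_apply, dlMat_apply, bandEntry_add_add]
    rfl

theorem sylv_eq_fromCols (m : ℕ) (d n : Fin (m + 1) → ℝ) :
    sylv m d n = (fromCols (dlMat m d) (nMat m n)).submatrix id finSumFinEquiv.symm := by
  ext r c
  refine Fin.addCases (fun i => ?_) (fun i => ?_) r <;>
  refine Fin.addCases (fun j => ?_) (fun j => ?_) c <;>
  simp [sylv, dlMat, nMat, -Fin.natAdd_eq_addNat]

theorem tSub_eq_mul_lastRows (m : ℕ) (d n : Fin (m + 1) → ℝ) (hd : ∀ k, d k ≠ 0)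
    (hS : IsUnit (sylv m d n)) (i : Fin (m + 1)) :
    tSub m d i = (tSub m d i * nMat m n) * lastRows m (sylv m d n)⁻¹ := by
  have hTS : tSub m d i * sylv m d n =
      (fromCols 0 (tSub m d i * nMat m n)).submatrix id finSumFinEquiv.symm := by
    rw [sylv_eq_fromCols, ← tSub_mul_dlMat m d hd i, ← mul_fromCols]
    rfl
  conv_lhs => rw [← mul_nonsing_inv_cancel_right (sylv m d n) (tSub m d i)
    ((isUnit_iff_isUnit_det _).1 hS), hTS]
  ext r c
  rw [mul_apply, Fin.sum_univ_add, mul_apply]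
  simp only [submatrix_apply, id, finSumFinEquiv_symm_apply_castAdd,
    finSumFinEquiv_symm_apply_natAdd, fromCols_apply_inl, fromCols_apply_inr, Matrix.zero_apply,
    zero_mul, Finset.sum_const_zero, zero_add]
  rfl

theorem subCols_tSub_revIdx (m : ℕ) (d : Fin (m + 1) → ℝ) (i : Fin (m + 1)) :
    subCols m (tSub m d i) (revIdx m i) = 1 := by
  ext r c
  have hidx : (⟨i + (revIdx m i + c), by simp only [revIdx]; omega⟩ : Fin (m + m + m)) =
      Fin.castAdd m (Fin.natAdd m c) := Fin.ext (by simp [revIdx]; omega)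
  change kerT m d r ⟨i + (revIdx m i + c), _⟩ = _
  rw [hidx]
  simp [kerT, -Fin.natAdd_eq_addNat]

theorem subCols_mul (m : ℕ) (X : Matrix (Fin m) (Fin m) ℝ) (M : Matrix (Fin m) (Fin (m + m)) ℝ)
    (i : Fin (m + 1)) : subCols m (X * M) i = X * subCols m M i :=
  rfl

theorem revIdx_revIdx (m : ℕ) (i : Fin (m + 1)) : revIdx m (revIdx m i) = i :=
  Fin.ext (by simp only [revIdx]; omega)

theorem tSub_eq_inv_bSub_mul (m : ℕ) (hm : 1 ≤ m) (d n : Fin (m + 1) → ℝ) (hd : ∀ k, d k ≠ 0) (hn : ∀ k, n k ≠ 0)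
    (hS : IsUnit (sylv m d n)) :
    ∀ i : Fin (m + 1),
      IsUnit (subCols m (lastRows m (sylv m d n)⁻¹) (revIdx m i)) ∧
        tSub m d i = (subCols m (lastRows m (sylv m d n)⁻¹) (revIdx m i))⁻¹ * (lastRows m (sylv m d n)⁻¹) ∧
          (subCols m (lastRows m (sylv m d n)⁻¹) i)⁻¹ * (lastRows m (sylv m d n)⁻¹) = tSub m d (revIdx m i) := by
  have key : ∀ i : Fin (m + 1),
      IsUnit (subCols m (lastRows m (sylv m d n)⁻¹) (revIdx m i)) ∧
        tSub m d i = (subCols m (lastRows m (sylv m d n)⁻¹) (revIdx m i))⁻¹ *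
          lastRows m (sylv m d n)⁻¹ := by
    intro i
    have hT := tSub_eq_mul_lastRows m d n hd hS i
    have hX : (tSub m d i * nMat m n) * subCols m (lastRows m (sylv m d n)⁻¹) (revIdx m i) = 1 := by
      rw [← subCols_mul, ← hT, subCols_tSub_revIdx]
    refine ⟨IsUnit.of_mul_eq_one_right _ hX, ?_⟩
    rwa [inv_eq_left_inv hX]
  intro i
  refine ⟨(key i).1, (key i).2, ?_⟩
  have h := (key (revIdx m i)).2
  rw [revIdx_revIdx] at h
  exact h.symm
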